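/- arXiv:1612.07918 — 3 statements merged into one kernel-verified Lean document; each statement's English description precedes it below -/
import Mathlib

section
/- The dynamic pressure p attains its maximum value exactly at the wave crest, is strictly positive in the fluid domain, and decays to zero far away from the crest. Precisely: p(x,y) < p(0,η(0)) = g·η(0) for every point (x,y) in the closure of Ω with (x,y) ≠ (0,η(0)); p(x,y) > 0 for every (x,y) ∈ Ω; and for every ε > 0 there exists R > 0 such that |p(x,y)| < ε for all (x,y) ∈ Ω with |x| > R. -/
open Real Filter Set

/-- Partial derivative in the first (horizontal) variable. -/
noncomputable def pdx (f : ℝ → ℝ → ℝ) (x y : ℝ) : ℝ := deriv (fun t => f t y) x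

/-- Partial derivative in the second (vertical) variable. -/
noncomputable def pdy (f : ℝ → ℝ → ℝ) (x y : ℝ) : ℝ := deriv (fun t => f x t) y

open Complex in
/-- A maximum principle on the strip `|im w| < h (re w)`, with the boundary condition at infinity
given by a limit superior. -/
theorem norm_lt_of_strip {h : ℝ → ℝ} (hcont : Continuous h) (hpos : ∀ x, 0 < h x) {B : ℝ}
    (hB : ∀ x, h x ≤ B) {H : ℂ → ℂ} (hHc : ContinuousOn H {w | |w.im| ≤ h w.re})
    (hHd : DifferentiableOn ℂ H {w | |w.im| < h w.re}) {M : ℝ}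
    (hM : ∀ w : ℂ, |w.im| = h w.re → ‖H w‖ ≤ M)
    (hinf : ∀ ε > 0, ∃ R, ∀ w : ℂ, |w.im| ≤ h w.re → R < |w.re| → ‖H w‖ ≤ M + ε)
    {w₁ : ℂ} (hw₁ : |w₁.im| = h w₁.re) (hlt : ‖H w₁‖ < M) {w : ℂ} (hw : |w.im| < h w.re) :
    ‖H w‖ < M := by
  set U : Set ℂ := {w | |w.im| < h w.re}
  have hcr : Continuous fun w : ℂ => h w.re := hcont.comp continuous_re
  have hci : Continuous fun w : ℂ => |w.im| := continuous_im.abs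
  have hUo : IsOpen U := isOpen_lt hci hcr
  have hle : ∀ z ∈ U, ‖H z‖ ≤ M := by
    intro z hz
    refine le_of_forall_pos_le_add fun ε hε => ?_
    obtain ⟨R, hR⟩ := hinf ε hε
    set R' := max R |z.re| + 1
    have hRR : R < R' := (le_max_left _ _).trans_lt (lt_add_one _)
    have hzR : |z.re| < R' := (le_max_right _ _).trans_lt (lt_add_one _)
    have hcre : Continuous fun w : ℂ => |w.re| := continuous_re.abs
    set V : Set ℂ := U ∩ {w | |w.re| < R'}
    have hcl : closure U ⊆ {w | |w.im| ≤ h w.re} := closure_lt_subset_le hci hcr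
    have hclV : closure V ⊆ {w | |w.im| ≤ h w.re} := (closure_mono inter_subset_left).trans hcl
    refine norm_le_of_forall_mem_frontier_norm_le (U := V) ?_ ⟨hHd.mono inter_subset_left, hHc.mono hclV⟩ ?_
      (subset_closure ⟨hz, hzR⟩)
    · refine (Metric.isBounded_closedBall (x := (0 : ℂ)) (r := R' + B)).subset fun w hw => ?_
      rw [mem_closedBall_zero_iff]
      have h1 : |w.im| < h w.re := hw.1
      have h2 : |w.re| < R' := hw.2
      linarith [norm_le_abs_re_add_abs_im w, hB w.re]
    · intro w hw
      rcases frontier_inter_subset _ _ hw with hw | hw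
      · have h1 : |w.im| = h w.re := frontier_lt_subset_eq hci hcr hw.1
        linarith [hM w h1]
      · have h1 : |w.re| = R' := frontier_lt_subset_eq hcre continuous_const hw.2
        exact hR w (hcl hw.1) (h1 ▸ hRR)
  refine lt_of_le_of_ne (hle w hw) fun heq => ?_
  have hUc : IsPreconnected U := by
    have hcs : Continuous fun q : ℝ × ℝ => (q.1 : ℂ) + (q.2 * h q.1 : ℝ) * I := by fun_prop
    have himg : U = (fun q : ℝ × ℝ => (q.1 : ℂ) + (q.2 * h q.1 : ℝ) * I) '' (univ ×ˢ Ioo (-1) 1) := by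
      ext z
      constructor
      · intro hz
        have hz' : |z.im| < h z.re := hz
        rw [abs_lt] at hz'
        refine ⟨(z.re, z.im / h z.re), ⟨mem_univ _, ?_, ?_⟩, ?_⟩
        · rw [lt_div_iff₀ (hpos _)]; linarith
        · rw [div_lt_iff₀ (hpos _)]; linarith
        · have := (hpos z.re).ne'
          apply Complex.ext <;> simp [this]
      · rintro ⟨⟨x, t⟩, ⟨-, ht⟩, rfl⟩
        have ht' : |t| < 1 := abs_lt.2 ht
        have hx := hpos x
        simp only [U, mem_ofPred_eq, add_re, add_im, ofReal_re, ofReal_im, re_ofReal_mul,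
          im_ofReal_mul, I_re, I_im, mul_zero, mul_one, add_zero, zero_add, abs_mul, abs_of_pos hx]
        nlinarith
    rw [himg]
    exact (isPreconnected_univ.prod isPreconnected_Ioo).image _ hcs.continuousOn
  have hconst := norm_eqOn_of_isPreconnected_of_isMaxOn hUc hUo hHd hw
    (fun z hz => (hle z hz).trans heq.ge)
  have hw₁c : w₁ ∈ closure U := by
    have hcs : Continuous fun t : ℝ => (w₁.re : ℂ) + (t * w₁.im : ℝ) * I := by fun_prop
    have hmem : (1 : ℝ) ∈ closure (Ioo (0 : ℝ) 1) := by
      rw [closure_Ioo zero_ne_one]; simp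
    have key := map_mem_closure (t := U) hcs hmem fun t ht => by
      have hx := hpos w₁.re
      simp only [U, mem_ofPred_eq, add_re, add_im, ofReal_re, ofReal_im, re_ofReal_mul,
          im_ofReal_mul, I_re, I_im, mul_zero, mul_one, add_zero, zero_add, abs_mul, hw₁,
          abs_of_pos ht.1]
      nlinarith [ht.2]
    simpa using key
  have hw₁S : w₁ ∈ {w : ℂ | |w.im| ≤ h w.re} := hw₁.le
  have hUS : U ⊆ {w : ℂ | |w.im| ≤ h w.re} := fun z hz => le_of_lt (α := ℝ) hz
  have := mem_closure_iff_nhdsWithin_neBot.1 hw₁c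
  have ht1 : Tendsto (fun z => ‖H z‖) (nhdsWithin w₁ U) (nhds ‖H w₁‖) :=
    ((hHc w₁ hw₁S).mono hUS).norm
  have ht2 : Tendsto (fun z => ‖H z‖) (nhdsWithin w₁ U) (nhds M) := by
    refine tendsto_const_nhds.congr' ?_
    filter_upwards [self_mem_nhdsWithin] with z hz
    have := hconst hz
    simp only [Function.comp, Function.const] at this
    rw [this, heq]
  exact hlt.ne (tendsto_nhds_unique ht1 ht2)

theorem hasFDerivAt_pdx_pdy {u : ℝ → ℝ → ℝ} (hu : Differentiable ℝ fun q : ℝ × ℝ => u q.1 q.2)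
    (x y : ℝ) : HasFDerivAt (fun q : ℝ × ℝ => u q.1 q.2)
      (pdx u x y • ContinuousLinearMap.fst ℝ ℝ ℝ + pdy u x y • ContinuousLinearMap.snd ℝ ℝ ℝ)
      (x, y) := by
  have h := (hu (x, y)).hasFDerivAt
  have h1 := h.comp_hasDerivAt_of_eq x ((hasDerivAt_id x).prodMk (hasDerivAt_const x y)) rfl
  have h2 := h.comp_hasDerivAt_of_eq y ((hasDerivAt_const y x).prodMk (hasDerivAt_id y)) rfl
  convert h using 1
  have e1 : pdx u x y = _ := h1.deriv
  have e2 : pdy u x y = _ := h2.deriv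
  ext <;> simp [e1, e2]

theorem hasDerivAt_pdx {u : ℝ → ℝ → ℝ} (hu : Differentiable ℝ fun q : ℝ × ℝ => u q.1 q.2)
    (x y : ℝ) : HasDerivAt (fun t => u t y) (pdx u x y) x :=
  ((hu.comp (by fun_prop : Differentiable ℝ fun t : ℝ => (t, y))) x).hasDerivAt

theorem hasDerivAt_pdy {u : ℝ → ℝ → ℝ} (hu : Differentiable ℝ fun q : ℝ × ℝ => u q.1 q.2)
    (x y : ℝ) : HasDerivAt (fun t => u x t) (pdy u x y) y :=
  ((hu.comp (by fun_prop : Differentiable ℝ fun t : ℝ => (x, t))) y).hasDerivAt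

open Complex in
/-- The complex velocity `u - i v` is holomorphic where `(u, v)` is divergence and curl free. -/
theorem hasDerivAt_complexVelocity {u v : ℝ → ℝ → ℝ}
    (hu : Differentiable ℝ fun q : ℝ × ℝ => u q.1 q.2)
    (hv : Differentiable ℝ fun q : ℝ × ℝ => v q.1 q.2) (w : ℂ)
    (hdiv : pdx u w.re w.im + pdy v w.re w.im = 0)
    (hcurl : pdy u w.re w.im - pdx v w.re w.im = 0) :
    HasDerivAt (fun z : ℂ => (u z.re z.im : ℂ) - v z.re z.im * I)
      (pdx u w.re w.im - pdx v w.re w.im * I) w := by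
  have hpair : HasFDerivAt (fun z : ℂ => (z.re, z.im)) (reCLM.prod imCLM) w :=
    reCLM.hasFDerivAt.prodMk imCLM.hasFDerivAt
  have hu' := ofRealCLM.hasFDerivAt.comp w
    ((hasFDerivAt_pdx_pdy hu w.re w.im).comp w hpair)
  have hv' := ofRealCLM.hasFDerivAt.comp w
    ((hasFDerivAt_pdx_pdy hv w.re w.im).comp w hpair)
  have hd := hu'.sub (hv'.mul_const I)
  refine HasDerivAt.congr_deriv (hasFDerivAt_of_restrictScalars ℝ
    (f' := ContinuousLinearMap.toSpanSingleton ℂ (pdx u w.re w.im - pdx v w.re w.im * I : ℂ))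
    hd ?_).hasDerivAt (by simp)
  have h1 : pdy u w.re w.im = pdx v w.re w.im := by linarith
  have h2 : pdy v w.re w.im = -pdx u w.re w.im := by linarith
  ext z
  apply Complex.ext <;> simp [h1, h2] <;> ring

open Complex in
/-- Schwarz reflection across the real axis. -/
noncomputable def schwarzExtension (f : ℂ → ℂ) (z : ℂ) : ℂ :=
  if 0 ≤ z.im then f z else (starRingEnd ℂ) (f ((starRingEnd ℂ) z))

open Complex in
theorem differentiableAt_schwarzExtension {f : ℂ → ℂ} (hreal : ∀ x : ℝ, (f x).im = 0) {w : ℂ}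
    (hf : DifferentiableAt ℂ f (w.re + |w.im| * I)) :
    DifferentiableAt ℂ (schwarzExtension f) w := by
  rcases lt_trichotomy w.im 0 with hw | hw | hw
  · have e : ((w.re : ℂ) + |w.im| * I) = (starRingEnd ℂ) w := by
      apply Complex.ext <;> simp [abs_of_neg hw]
    rw [e] at hf
    have h1 := hf.conj_conj
    rw [conj_conj] at h1
    refine h1.congr_of_eventuallyEq ?_
    filter_upwards [(isOpen_lt continuous_im continuous_const).mem_nhds hw] with z hz
    have hz' : z.im < 0 := hz
    simp [schwarzExtension, not_le.2 hz']
  · have e : ((w.re : ℂ) + |w.im| * I) = w := by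
      apply Complex.ext <;> simp [hw]
    rw [e] at hf
    have hwr : w = (w.re : ℂ) := by apply Complex.ext <;> simp [hw]
    have hd := hf.hasDerivAt
    have him : (deriv f w).im = 0 := by
      rw [hwr] at hd ⊢
      have h1 := ((hasDerivAt_const (x := ((w.re : ℝ) : ℂ)) (c := -I)).mul hd).real_of_complex
      have h2 : (fun x : ℝ => ((fun _ : ℂ => -I) * f) (x : ℂ) |>.re) = fun _ => 0 := by
        funext x; simp [hreal x]
      rw [h2] at h1
      simpa using h1.unique (hasDerivAt_const (w.re : ℝ) (0 : ℝ))
    have hd2 := hd.conj_conj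
    rw [conj_eq_iff_im.2 him, conj_eq_iff_im.2 hw] at hd2
    have hun : {z : ℂ | 0 ≤ z.im} ∪ {z : ℂ | z.im < 0} = univ := by
      ext z; simpa using le_or_gt 0 z.im
    have h3 : HasDerivWithinAt (schwarzExtension f) (deriv f w)
        ({z : ℂ | 0 ≤ z.im} ∪ {z : ℂ | z.im < 0}) w := by
      refine HasDerivWithinAt.union ?_ ?_
      · refine hd.hasDerivWithinAt.congr (fun z hz => if_pos hz) (if_pos hw.ge)
      · refine hd2.hasDerivWithinAt.congr (fun z hz => if_neg (not_le.2 hz)) ?_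
        have : (f w).im = 0 := by rw [hwr]; exact hreal _
        simp [schwarzExtension, hw, conj_eq_iff_im.2 hw, conj_eq_iff_im.2 this]
    rw [hun, hasDerivWithinAt_univ] at h3
    exact h3.differentiableAt
  · have e : ((w.re : ℂ) + |w.im| * I) = w := by
      apply Complex.ext <;> simp [abs_of_pos hw]
    rw [e] at hf
    refine hf.congr_of_eventuallyEq ?_
    filter_upwards [(isOpen_lt continuous_const continuous_im).mem_nhds hw] with z hz
    exact if_pos (le_of_lt (α := ℝ) hz)

open Complex in
theorem continuous_schwarzExtension {f : ℂ → ℂ} (hf : Continuous f)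
    (hreal : ∀ x : ℝ, (f x).im = 0) : Continuous (schwarzExtension f) := by
  refine Continuous.if_le hf (by fun_prop) continuous_const continuous_im fun z hz => ?_
  have hz' : z = (z.re : ℂ) := by apply Complex.ext <;> simp [← hz]
  rw [hz', conj_ofReal, conj_eq_iff_im.2 (hreal _)]

open Complex in
theorem norm_schwarzExtension (f : ℂ → ℂ) (w : ℂ) :
    ‖schwarzExtension f w‖ = ‖f (w.re + |w.im| * I)‖ := by
  unfold schwarzExtension
  split_ifs with hw
  · rw [abs_of_nonneg hw, re_add_im]
  · rw [norm_conj]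
    congr 2
    apply Complex.ext <;> simp [abs_of_neg (not_le.1 hw)]

theorem closure_strip {η : ℝ → ℝ} (hη : Continuous η) {a : ℝ} (ha : ∀ x, a < η x) :
    closure {q : ℝ × ℝ | a < q.2 ∧ q.2 < η q.1} = {q | a ≤ q.2 ∧ q.2 ≤ η q.1} := by
  apply Subset.antisymm
  · refine closure_minimal (fun q hq => ⟨hq.1.le, hq.2.le⟩) ?_
    exact (isClosed_le continuous_const continuous_snd).inter
      (isClosed_le continuous_snd (hη.comp continuous_fst))
  · rintro ⟨x, y⟩ hq
    have hy : y ∈ closure (Ioo a (η x)) := by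
      rw [closure_Ioo (ha x).ne]; exact hq
    exact map_mem_closure (by fun_prop : Continuous fun t : ℝ => (x, t)) hy fun t ht => ht

/-- Bernoulli's law: the total head of a steady irrotational flow is constant. -/
theorem bernoulli_steady_irrotational {η : ℝ → ℝ} {d g c : ℝ} {u v P : ℝ → ℝ → ℝ} (hηd : ∀ x, -d ≤ η x)
    (hu : Differentiable ℝ fun q : ℝ × ℝ => u q.1 q.2)
    (hv : Differentiable ℝ fun q : ℝ × ℝ => v q.1 q.2)
    (hP : Differentiable ℝ fun q : ℝ × ℝ => P q.1 q.2)
    (hirr : ∀ x y, -d ≤ y → y ≤ η x → pdy u x y - pdx v x y = 0)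
    (heuler1 : ∀ x y, -d ≤ y → y ≤ η x →
      (u x y - c) * pdx u x y + v x y * pdy u x y = -pdx P x y)
    (heuler2 : ∀ x y, -d ≤ y → y ≤ η x →
      (u x y - c) * pdx v x y + v x y * pdy v x y = -pdy P x y - g) {x y : ℝ}
    (hdy : -d ≤ y) (hyη : y ≤ η x) :
    ((u x y - c) ^ 2 + v x y ^ 2) / 2 + P x y + g * y =
      ((u 0 (-d) - c) ^ 2 + v 0 (-d) ^ 2) / 2 + P 0 (-d) + g * -d := by
  set E : ℝ → ℝ → ℝ := fun x y => ((u x y - c) ^ 2 + v x y ^ 2) / 2 + P x y + g * y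
  have hEx : ∀ x y, -d ≤ y → y ≤ η x → HasDerivAt (fun t => E t y) 0 x := by
    intro x y h1 h2
    refine ((((((hasDerivAt_pdx hu x y).sub_const c).pow 2).add
      ((hasDerivAt_pdx hv x y).pow 2)).div_const 2).add
      (hasDerivAt_pdx hP x y)).add_const (g * y) |>.congr_deriv ?_
    have := heuler1 x y h1 h2
    have := hirr x y h1 h2
    have e : pdx v x y = pdy u x y := by linarith
    rw [e]
    norm_num
    linarith
  have hEy : ∀ x y, -d ≤ y → y ≤ η x → HasDerivAt (fun t => E x t) 0 y := by
    intro x y h1 h2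
    refine ((((((hasDerivAt_pdy hu x y).sub_const c).pow 2).add
      ((hasDerivAt_pdy hv x y).pow 2)).div_const 2).add
      (hasDerivAt_pdy hP x y)).add ((hasDerivAt_id y).const_mul g) |>.congr_deriv ?_
    have := heuler2 x y h1 h2
    have := hirr x y h1 h2
    have e : pdy u x y = pdx v x y := by linarith
    rw [e]
    norm_num
    linarith
  have hbed : E x (-d) = E 0 (-d) :=
    is_const_of_deriv_eq_zero (f := fun t => E t (-d))
      (fun t => (hEx t _ le_rfl (hηd t)).differentiableAt)
      (fun t => (hEx t _ le_rfl (hηd t)).deriv) x 0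
  have hvert : E x y = E x (-d) :=
    constant_of_has_deriv_right_zero (f := fun t => E x t) (a := -d) (b := η x)
      (fun t ht => (hEy x t ht.1 ht.2).continuousAt.continuousWithinAt)
      (fun t ht => (hEy x t ht.1 ht.2.le).hasDerivWithinAt) y ⟨hdy, hyη⟩
  exact hvert.trans hbed

theorem lt_apply_zero_of_even_strictAntiOn {η : ℝ → ℝ} (hη : Continuous η)
    (heven : ∀ x, η (-x) = η x) (hdec : StrictAntiOn η (Ioi 0)) {x : ℝ} (hx : x ≠ 0) :
    η x < η 0 := by
  have key : ∀ x, 0 < x → η x < η 0 := by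
    intro x hx
    have h1 : η x < η (x / 2) := hdec (mem_Ioi.2 (by linarith)) (mem_Ioi.2 hx) (by linarith)
    refine h1.trans_le ?_
    have ht : Tendsto η (nhdsWithin 0 (Ioi 0)) (nhds (η 0)) := hη.continuousWithinAt
    refine ge_of_tendsto ht ?_
    filter_upwards [Ioo_mem_nhdsGT (show (0 : ℝ) < x / 2 by linarith)] with t ht
    exact (hdec (mem_Ioi.2 ht.1) (mem_Ioi.2 (by linarith)) ht.2).le
  rcases lt_or_gt_of_ne hx with h | h
  · rw [← heven]; exact key _ (by linarith)
  · exact key x h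

theorem pos_of_even_strictAntiOn {η : ℝ → ℝ} (hη : Continuous η)
    (heven : ∀ x, η (-x) = η x) (hdec : StrictAntiOn η (Ioi 0))
    (hlim : Tendsto η atTop (nhds 0)) (x : ℝ) : 0 < η x := by
  have key : ∀ x, 0 < x → 0 < η x := by
    intro x hx
    have h1 : η (x + 1) < η x := hdec (mem_Ioi.2 hx) (mem_Ioi.2 (by linarith)) (by linarith)
    refine lt_of_le_of_lt (le_of_tendsto hlim ?_) h1
    filter_upwards [eventually_gt_atTop (x + 1)] with t ht
    exact (hdec (mem_Ioi.2 (by linarith)) (mem_Ioi.2 (by linarith)) ht).le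
  rcases lt_trichotomy x 0 with h | h | h
  · rw [← heven]; exact key _ (by linarith)
  · rw [h]
    exact (key 1 one_pos).trans
      (lt_apply_zero_of_even_strictAntiOn hη heven hdec one_ne_zero)
  · exact key x h

/-- The dynamic pressure in a smooth irrotational solitary wave attains its maximum
value exactly at the wave crest `(0, η 0)`, is strictly positive in the fluid domain,
and decays to zero far away from the crest. -/
theorem dynamic_pressure_extrema
    (d g c P_atm : ℝ) (hd : 0 < d) (hg : 0 < g) (hc : Real.sqrt (g * d) < c)
    (η : ℝ → ℝ) (hη : ContDiff ℝ (⊤ : ℕ∞) η)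
    (hηd : ∀ x, -d < η x) (hηeven : ∀ x, η (-x) = η x)
    (hηdec : StrictAntiOn η (Set.Ioi 0))
    (hηlim : Filter.Tendsto η (Filter.cocompact ℝ) (nhds 0))
    (Ω : Set (ℝ × ℝ)) (hΩ : Ω = {q : ℝ × ℝ | -d < q.2 ∧ q.2 < η q.1})
    (u v P : ℝ → ℝ → ℝ)
    (hu : ContDiff ℝ (⊤ : ℕ∞) (fun q : ℝ × ℝ => u q.1 q.2))
    (hv : ContDiff ℝ (⊤ : ℕ∞) (fun q : ℝ × ℝ => v q.1 q.2))
    (hP : ContDiff ℝ (⊤ : ℕ∞) (fun q : ℝ × ℝ => P q.1 q.2))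
    (hinc : ∀ x y, (x, y) ∈ closure Ω → pdx u x y + pdy v x y = 0)
    (hirr : ∀ x y, (x, y) ∈ closure Ω → pdy u x y - pdx v x y = 0)
    (heuler1 : ∀ x y, (x, y) ∈ closure Ω →
      (u x y - c) * pdx u x y + v x y * pdy u x y = -pdx P x y)
    (heuler2 : ∀ x y, (x, y) ∈ closure Ω →
      (u x y - c) * pdx v x y + v x y * pdy v x y = -pdy P x y - g)
    (hsurfP : ∀ x, P x (η x) = P_atm)
    (hsurfv : ∀ x, v x (η x) = (u x (η x) - c) * deriv η x)
    (hbed : ∀ x, v x (-d) = 0)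
    (husym : ∀ x y, u (-x) y = u x y)
    (hvsym : ∀ x y, v (-x) y = -v x y)
    (huc : ∀ x y, (x, y) ∈ closure Ω → u x y < c)
    (hulim : ∀ ε > 0, ∃ R > 0, ∀ x y, (x, y) ∈ closure Ω → R < |x| → |u x y| < ε)
    (hvlim : ∀ ε > 0, ∃ R > 0, ∀ x y, (x, y) ∈ closure Ω → R < |x| → |v x y| < ε)
    (p : ℝ → ℝ → ℝ) (hp : ∀ x y, p x y = P x y - (P_atm - g * y)) :
    (∀ x y, (x, y) ∈ closure Ω → (x, y) ≠ (0, η 0) → p x y < p 0 (η 0)) ∧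
    p 0 (η 0) = g * η 0 ∧
    (∀ x y, (x, y) ∈ Ω → 0 < p x y) ∧
    (∀ ε > 0, ∃ R > 0, ∀ x y, (x, y) ∈ Ω → R < |x| → |p x y| < ε) := by

  have hηc : Continuous η := hη.continuous
  have hud : Differentiable ℝ fun q : ℝ × ℝ => u q.1 q.2 := hu.differentiable (by simp)
  have hvd : Differentiable ℝ fun q : ℝ × ℝ => v q.1 q.2 := hv.differentiable (by simp)
  have hPd : Differentiable ℝ fun q : ℝ × ℝ => P q.1 q.2 := hP.differentiable (by simp)
  have hcl : ∀ x y, (x, y) ∈ closure Ω ↔ -d ≤ y ∧ y ≤ η x := fun x y => by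
    rw [hΩ, closure_strip hηc hηd]; rfl
  have hc0 : 0 < c := (Real.sqrt_nonneg _).trans_lt hc
  have hηtop : Tendsto η atTop (nhds 0) :=
    hηlim.mono_left atTop_le_cocompact
  have hηpos := pos_of_even_strictAntiOn hηc hηeven hηdec hηtop
  have hηlt : ∀ x, x ≠ 0 → η x < η 0 := fun x hx =>
    lt_apply_zero_of_even_strictAntiOn hηc hηeven hηdec hx
  have hηle : ∀ x, η x ≤ η 0 := fun x => by
    rcases eq_or_ne x 0 with h | h
    · rw [h]
    · exact (hηlt x h).le
  have hsurf : ∀ x, (x, η x) ∈ closure Ω := fun x => (hcl _ _).2 ⟨(hηd x).le, le_rfl⟩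
  have hpsurf : ∀ x, p x (η x) = g * η x := fun x => by rw [hp, hsurfP]; ring
  obtain ⟨K, hK⟩ : ∃ K, ∀ x y, (x, y) ∈ closure Ω →
      ((u x y - c) ^ 2 + v x y ^ 2) / 2 + P x y + g * y = K :=
    ⟨_, fun x y h => bernoulli_steady_irrotational (fun x => (hηd x).le) hud hvd hPd
      (fun x y h1 h2 => hirr x y ((hcl x y).2 ⟨h1, h2⟩))
      (fun x y h1 h2 => heuler1 x y ((hcl x y).2 ⟨h1, h2⟩))
      (fun x y h1 h2 => heuler2 x y ((hcl x y).2 ⟨h1, h2⟩)) ((hcl x y).1 h).1 ((hcl x y).1 h).2⟩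
  have hlim_surf : ∀ f : ℝ → ℝ → ℝ,
      (∀ ε > 0, ∃ R > 0, ∀ x y, (x, y) ∈ closure Ω → R < |x| → |f x y| < ε) →
      Tendsto (fun x => f x (η x)) atTop (nhds 0) := by
    intro f hf
    rw [Metric.tendsto_nhds]
    intro ε hε
    obtain ⟨R, hR0, hR⟩ := hf ε hε
    filter_upwards [eventually_gt_atTop R] with x hx
    rw [Real.dist_eq, sub_zero]
    exact hR x _ (hsurf x) (hx.trans_le (le_abs_self x))
  have hKval : K = c ^ 2 / 2 + P_atm := by
    have h1 : Tendsto (fun x => ((u x (η x) - c) ^ 2 + v x (η x) ^ 2) / 2 + P_atm + g * η x) atTop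
        (nhds (((0 - c) ^ 2 + 0 ^ 2) / 2 + P_atm + g * 0)) :=
      ((((((hlim_surf u hulim).sub_const c).pow 2).add
        ((hlim_surf v hvlim).pow 2)).div_const 2).add_const P_atm).add (hηtop.const_mul g)
    have h2 : (fun x => ((u x (η x) - c) ^ 2 + v x (η x) ^ 2) / 2 + P_atm + g * η x) =
        fun _ => K := by
      funext x
      rw [← hK x (η x) (hsurf x), hsurfP]
    rw [h2] at h1
    have := tendsto_nhds_unique h1 tendsto_const_nhds
    rw [← this]; ring
  have hpq : ∀ x y, (x, y) ∈ closure Ω → (u x y - c) ^ 2 + v x y ^ 2 = c ^ 2 - 2 * p x y := by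
    intro x y h
    have := hK x y h
    rw [hp]
    linarith
  have hdecay : ∀ ε > 0, ∃ R > 0, ∀ x y, (x, y) ∈ closure Ω → R < |x| → |p x y| < ε := by
    intro ε hε
    set δ := min 1 (ε / (c + 1))
    have hδ : 0 < δ := lt_min one_pos (by positivity)
    have hδ1 : δ ≤ 1 := min_le_left _ _
    have hδ2 : δ * (c + 1) ≤ ε := (le_div_iff₀ (by positivity)).1 (min_le_right _ _)
    obtain ⟨R₁, hR₁, h1⟩ := hulim δ hδ
    obtain ⟨R₂, hR₂, h2⟩ := hvlim δ hδ
    refine ⟨max R₁ R₂, lt_max_of_lt_left hR₁, fun x y h hx => ?_⟩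
    have hU := abs_lt.1 (h1 x y h ((le_max_left _ _).trans_lt hx))
    have hV := abs_lt.1 (h2 x y h ((le_max_right _ _).trans_lt hx))
    have := hpq x y h
    have hu2 : u x y ^ 2 < δ ^ 2 := sq_lt_sq' hU.1 hU.2
    have hv2 : v x y ^ 2 < δ ^ 2 := sq_lt_sq' hV.1 hV.2
    have e : p x y = u x y * c - (u x y ^ 2 + v x y ^ 2) / 2 := by linarith
    have h3 : u x y * c < δ * c := mul_lt_mul_of_pos_right hU.2 hc0
    have h4 : -δ * c < u x y * c := mul_lt_mul_of_pos_right hU.1 hc0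
    rw [e, abs_lt]
    constructor <;> nlinarith [sq_nonneg (u x y), sq_nonneg (v x y)]
  set h : ℝ → ℝ := fun x => η x + d with hh
  have hhc : Continuous h := by fun_prop
  have hhpos : ∀ x, 0 < h x := fun x => by linarith [hηd x]
  have hhB : ∀ x, h x ≤ η 0 + d := fun x => by linarith [hηle x]
  set f : ℂ → ℂ := fun w =>
    ((u w.re (w.im - d) - c : ℝ) : ℂ) - (v w.re (w.im - d) : ℝ) * Complex.I
  have hfreal : ∀ x : ℝ, (f x).im = 0 := fun x => by simp [f, hbed]
  have hfc : Continuous f := by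
    have h1 : Continuous fun w : ℂ => (w.re, w.im - d) := by fun_prop
    have h2 := hud.continuous.comp h1
    have h3 := hvd.continuous.comp h1
    exact (Complex.continuous_ofReal.comp (h2.sub continuous_const)).sub
      ((Complex.continuous_ofReal.comp h3).mul continuous_const)
  set F := schwarzExtension f
  have hFc : Continuous F := continuous_schwarzExtension hfc hfreal
  have hmem : ∀ w : ℂ, |w.im| ≤ h w.re → (w.re, |w.im| - d) ∈ closure Ω := fun w hw =>
    (hcl _ _).2 ⟨by linarith [abs_nonneg w.im], by linarith⟩
  have hFd : DifferentiableOn ℂ F {w | |w.im| < h w.re} := by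
    intro w hw
    have hm := hmem w (le_of_lt (α := ℝ) hw)
    refine (differentiableAt_schwarzExtension hfreal ?_).differentiableWithinAt
    set z : ℂ := w.re + |w.im| * Complex.I - d * Complex.I with hz
    have hre : z.re = w.re := by simp [hz]
    have him : z.im = |w.im| - d := by simp [hz]
    have hpd : ∀ x y, pdx (fun x y => u x y - c) x y = pdx u x y ∧
        pdy (fun x y => u x y - c) x y = pdy u x y := fun x y =>
      ⟨deriv_sub_const _, deriv_sub_const _⟩
    have key := hasDerivAt_complexVelocity (u := fun x y => u x y - c) (v := v)
      (hud.sub_const c) hvd z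
      (by rw [hre, him, (hpd _ _).1]; exact hinc _ _ hm)
      (by rw [hre, him, (hpd _ _).2]; exact hirr _ _ hm)
    refine (key.comp_sub_const _ _).differentiableAt.congr_of_eventuallyEq
      (Eventually.of_forall fun t => ?_)
    simp [f]
  have hFnorm : ∀ w : ℂ, |w.im| ≤ h w.re → ‖F w‖ ^ 2 = c ^ 2 - 2 * p w.re (|w.im| - d) := by
    intro w hw
    rw [← hpq _ _ (hmem w hw), norm_schwarzExtension, Complex.sq_norm, Complex.normSq_apply]
    simp [f]
    ring
  have hFsurf : ∀ w : ℂ, |w.im| = h w.re → ‖F w‖ ^ 2 = c ^ 2 - 2 * (g * η w.re) := by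
    intro w hw
    rw [hFnorm w hw.le, hw, hh, add_sub_cancel_right, hpsurf]
  have hFne : ∀ w : ℂ, |w.im| ≤ h w.re → 0 < ‖F w‖ := by
    intro w hw
    have h1 := hpq _ _ (hmem w hw)
    have h2 := huc _ _ (hmem w hw)
    have h3 := hFnorm w hw
    rw [← h1] at h3
    have h4 : 0 < (u w.re (|w.im| - d) - c) ^ 2 := sq_pos_of_neg (by linarith)
    have : 0 < ‖F w‖ ^ 2 := by rw [h3]; positivity
    exact (norm_nonneg _).lt_of_ne fun h0 => by simp [← h0] at this
  have hFdecay : ∀ ε > 0, ∃ R, ∀ w : ℂ, |w.im| ≤ h w.re → R < |w.re| →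
      |p w.re (|w.im| - d)| < ε := fun ε hε => by
    obtain ⟨R, -, hR⟩ := hdecay ε hε
    exact ⟨R, fun w hw hwR => hR _ _ (hmem w hw) hwR⟩
  have hsurfim : ∀ x, |(⟨x, h x⟩ : ℂ).im| = h (⟨x, h x⟩ : ℂ).re := fun x => abs_of_pos (hhpos x)
  refine ⟨?_, hpsurf 0, ?_, fun ε hε => ?_⟩
  · intro x y hxy hne
    obtain ⟨hy1, hy2⟩ := (hcl x y).1 hxy
    rw [hpsurf]
    rcases hy2.eq_or_lt with rfl | hy2
    · rw [hpsurf]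
      have hx : x ≠ 0 := by rintro rfl; exact hne rfl
      exact mul_lt_mul_of_pos_left (hηlt x hx) hg
    set w₀ : ℂ := ⟨0, h 0⟩
    set m := ‖F w₀‖
    have hm0 : 0 < m := hFne _ (hsurfim 0).le
    have hm2 : m ^ 2 = c ^ 2 - 2 * (g * η 0) := hFsurf _ (hsurfim 0)
    have hw : |(⟨x, y + d⟩ : ℂ).im| < h (⟨x, y + d⟩ : ℂ).re := by
      simp only [abs_of_nonneg (show 0 ≤ y + d by linarith), hh]
      linarith
    have key := norm_lt_of_strip hhc hhpos hhB (H := fun z => (F z)⁻¹) (M := m⁻¹)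
      (hFc.continuousOn.inv₀ fun z hz => norm_pos_iff.1 (hFne z hz))
      (hFd.inv fun z hz => norm_pos_iff.1 (hFne z (le_of_lt (α := ℝ) hz)))
      (fun z hz => by
        rw [norm_inv]
        refine inv_anti₀ hm0 ((pow_le_pow_iff_left₀ (by positivity) (by positivity) two_ne_zero).1 ?_)
        rw [hm2, hFsurf z hz]
        nlinarith [hηle z.re])
      (fun ε hε => by
        obtain ⟨R, hR⟩ := hFdecay (g * η 0) (mul_pos hg (hηpos 0))
        refine ⟨R, fun z hz hzR => ?_⟩
        have h1 : ‖(F z)⁻¹‖ ≤ m⁻¹ := by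
          rw [norm_inv]
          refine inv_anti₀ hm0 ((pow_le_pow_iff_left₀ (by positivity) (by positivity) two_ne_zero).1 ?_)
          rw [hm2, hFnorm z hz]
          linarith [(abs_lt.1 (hR z hz hzR)).2]
        linarith)
      (hsurfim 1)
      (by
        rw [norm_inv]
        refine inv_strictAnti₀ hm0 (lt_of_pow_lt_pow_left₀ 2 (norm_nonneg _) ?_)
        rw [hm2, hFsurf _ (hsurfim 1)]
        nlinarith [hηlt 1 one_ne_zero])
      hw
    rw [norm_inv, inv_lt_inv₀ (hFne _ hw.le) hm0] at key
    have h2 := pow_lt_pow_left₀ key hm0.le two_ne_zero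
    rw [hm2, hFnorm _ hw.le] at h2
    simp only [abs_of_nonneg (show 0 ≤ y + d by linarith), add_sub_cancel_right] at h2
    linarith
  · intro x y hxy
    rw [hΩ] at hxy
    obtain ⟨hy1, hy2⟩ : -d < y ∧ y < η x := hxy
    have hw : |(⟨x, y + d⟩ : ℂ).im| < h (⟨x, y + d⟩ : ℂ).re := by
      simp only [abs_of_nonneg (show 0 ≤ y + d by linarith), hh]
      linarith
    have key := norm_lt_of_strip hhc hhpos hhB (H := F) (M := c) hFc.continuousOn hFd
      (fun z hz => by
        refine (pow_le_pow_iff_left₀ (by positivity) (by positivity) two_ne_zero).1 ?_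
        rw [hFsurf z hz]
        nlinarith [hηpos z.re])
      (fun ε hε => by
        obtain ⟨R, hR⟩ := hFdecay (c * ε) (mul_pos hc0 hε)
        refine ⟨R, fun z hz hzR => (pow_le_pow_iff_left₀ (by positivity) (by positivity) two_ne_zero).1 ?_⟩
        rw [hFnorm z hz]
        nlinarith [(abs_lt.1 (hR z hz hzR)).1])
      (hsurfim 0)
      (by
        refine lt_of_pow_lt_pow_left₀ 2 hc0.le ?_
        rw [hFsurf _ (hsurfim 0)]
        nlinarith [hηpos 0])
      hw
    have h2 := pow_lt_pow_left₀ key (norm_nonneg _) two_ne_zero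
    rw [hFnorm _ hw.le] at h2
    simp only [abs_of_nonneg (show 0 ≤ y + d by linarith), add_sub_cancel_right] at h2
    linarith
  · obtain ⟨R, hR0, hR⟩ := hdecay ε hε
    exact ⟨R, hR0, fun x y hxy => hR x y (subset_closure hxy)⟩
end

section
/- The vertical velocity is strictly positive in the right half of the fluid domain: v(x,y) > 0 for every (x,y) ∈ Ω₊ = {(x,y) ∈ ℝ² : x > 0, -d < y < η(x)}. -/
open Real Filter Set

theorem pdx_eq_fderiv {f : ℝ → ℝ → ℝ} {x y : ℝ}
    (hf : DifferentiableAt ℝ (fun q : ℝ × ℝ => f q.1 q.2) (x, y)) :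
    pdx f x y = fderiv ℝ (fun q : ℝ × ℝ => f q.1 q.2) (x, y) (1, 0) :=
  (hf.hasFDerivAt.comp_hasDerivAt x
    ((hasDerivAt_id x).prodMk (hasDerivAt_const x y)) :).deriv

theorem pdy_eq_fderiv {f : ℝ → ℝ → ℝ} {x y : ℝ}
    (hf : DifferentiableAt ℝ (fun q : ℝ × ℝ => f q.1 q.2) (x, y)) :
    pdy f x y = fderiv ℝ (fun q : ℝ × ℝ => f q.1 q.2) (x, y) (0, 1) :=
  (hf.hasFDerivAt.comp_hasDerivAt y
    ((hasDerivAt_const y x).prodMk (hasDerivAt_id y)) :).deriv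

/-- The exponential of `-i` times the complex velocity `u - i v`; its modulus is `exp (-v)`. -/
noncomputable def expVelocity (u v : ℝ → ℝ → ℝ) (z : ℂ) : ℂ :=
  Complex.exp (-Complex.I * ((u z.re z.im : ℂ) - Complex.I * (v z.re z.im : ℂ)))

theorem norm_expVelocity (u v : ℝ → ℝ → ℝ) (z : ℂ) :
    ‖expVelocity u v z‖ = Real.exp (-v z.re z.im) := by
  simp [expVelocity, Complex.norm_exp]

theorem continuous_expVelocity {u v : ℝ → ℝ → ℝ}
    (hu : Continuous (fun q : ℝ × ℝ => u q.1 q.2))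
    (hv : Continuous (fun q : ℝ × ℝ => v q.1 q.2)) : Continuous (expVelocity u v) := by
  have hz : Continuous fun z : ℂ => (z.re, z.im) := by fun_prop
  have hu' := hu.comp hz
  have hv' := hv.comp hz
  simp only [Function.comp_def] at hu' hv'
  unfold expVelocity
  fun_prop

/-- An incompressible irrotational velocity field yields a holomorphic complex velocity. -/
theorem differentiableAt_expVelocity {u v : ℝ → ℝ → ℝ} {z : ℂ}
    (hu : DifferentiableAt ℝ (fun q : ℝ × ℝ => u q.1 q.2) (z.re, z.im))
    (hv : DifferentiableAt ℝ (fun q : ℝ × ℝ => v q.1 q.2) (z.re, z.im))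
    (hinc : pdx u z.re z.im + pdy v z.re z.im = 0)
    (hirr : pdy u z.re z.im - pdx v z.re z.im = 0) :
    DifferentiableAt ℂ (expVelocity u v) z := by
  have hz : HasFDerivAt (fun z : ℂ => (z.re, z.im))
      (Complex.reCLM.prod Complex.imCLM) z :=
    (Complex.reCLM.prod Complex.imCLM).hasFDerivAt
  have hu' := Complex.ofRealCLM.hasFDerivAt.comp z (hu.hasFDerivAt.comp z hz)
  have hv' := Complex.ofRealCLM.hasFDerivAt.comp z (hv.hasFDerivAt.comp z hz)
  have hf : HasFDerivAt
      (fun z : ℂ => (u z.re z.im : ℂ) - Complex.I * (v z.re z.im : ℂ)) _ z :=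
    hu'.sub (hv'.const_mul Complex.I)
  have hd : DifferentiableAt ℂ
      (fun z : ℂ => (u z.re z.im : ℂ) - Complex.I * (v z.re z.im : ℂ)) z := by
    refine differentiableAt_complex_iff_differentiableAt_real.2 ⟨hf.differentiableAt, ?_⟩
    rw [pdx_eq_fderiv hu, pdy_eq_fderiv hv] at hinc
    rw [pdy_eq_fderiv hu, pdx_eq_fderiv hv] at hirr
    rw [hf.fderiv]
    apply Complex.ext <;> simp <;> linarith
  exact (hd.const_mul _).cexp

/-- The part of the fluid domain over `s`, as a subset of `ℂ`. -/
def fluidOver (d : ℝ) (η : ℝ → ℝ) (s : Set ℝ) : Set ℂ :=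
  {z | z.re ∈ s ∧ -d < z.im ∧ z.im < η z.re}

theorem isOpen_fluidOver {d : ℝ} {η : ℝ → ℝ} {s : Set ℝ} (hη : Continuous η)
    (hs : IsOpen s) : IsOpen (fluidOver d η s) :=
  (hs.preimage Complex.continuous_re).inter
    ((isOpen_lt continuous_const Complex.continuous_im).inter
      (isOpen_lt Complex.continuous_im (hη.comp Complex.continuous_re)))

theorem closure_fluidOver_subset {d : ℝ} {η : ℝ → ℝ} {s : Set ℝ} (hη : Continuous η) :
    closure (fluidOver d η s) ⊆
      {z | z.re ∈ closure s ∧ -d ≤ z.im ∧ z.im ≤ η z.re} := by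
  refine closure_minimal (fun z hz => ⟨subset_closure hz.1, hz.2.1.le, hz.2.2.le⟩) ?_
  exact (isClosed_closure.preimage Complex.continuous_re).inter
    ((isClosed_le continuous_const Complex.continuous_im).inter
      (isClosed_le Complex.continuous_im (hη.comp Complex.continuous_re)))

theorem isPreconnected_fluidOver {d : ℝ} {η : ℝ → ℝ} {s : Set ℝ} (hη : Continuous η)
    (hηd : ∀ x, -d < η x) (hs : IsPreconnected s) :
    IsPreconnected (fluidOver d η s) := by
  have himage : fluidOver d η s =
      (fun p : ℝ × ℝ => (⟨p.1, -d + p.2 * (η p.1 + d)⟩ : ℂ)) '' (s ×ˢ Ioo 0 1) := by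
    ext z
    constructor
    · rintro ⟨hzs, h₁, h₂⟩
      have hpos : 0 < η z.re + d := by linarith [hηd z.re]
      refine ⟨(z.re, (z.im + d) / (η z.re + d)), ⟨hzs, ?_, ?_⟩, ?_⟩
      · exact div_pos (by linarith) hpos
      · exact (div_lt_one hpos).2 (by linarith)
      · apply Complex.ext
        · rfl
        · simp only
          field_simp
          ring
    · rintro ⟨⟨x, t⟩, ⟨hxs, h₁, h₂⟩, rfl⟩
      have hpos : 0 < η x + d := by linarith [hηd x]
      simp only at h₁ h₂
      refine ⟨hxs, ?_, ?_⟩ <;> simp only <;> nlinarith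
  rw [himage]
  refine (hs.prod isPreconnected_Ioo).image _ (Continuous.continuousOn ?_)
  have : Continuous fun p : ℝ × ℝ => (p.1, -d + p.2 * (η p.1 + d)) := by fun_prop
  exact Complex.equivRealProdCLM.symm.continuous.comp this

theorem isBounded_fluidOver {d : ℝ} {η : ℝ → ℝ} {a b : ℝ} (hη : Continuous η) :
    Bornology.IsBounded (fluidOver d η (Ioo a b)) := by
  obtain ⟨M, hM⟩ := (isCompact_Icc (a := a) (b := b)).bddAbove_image hη.continuousOn
  refine ((Metric.isBounded_Icc a b).reProdIm (Metric.isBounded_Icc (-d) M)).subset ?_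
  rintro z ⟨hz, h₁, h₂⟩
  exact ⟨Ioo_subset_Icc_self hz, h₁.le,
    h₂.le.trans (hM (mem_image_of_mem _ (Ioo_subset_Icc_self hz)))⟩

theorem mem_closure_fluid {d x y : ℝ} {η : ℝ → ℝ} (hηd : -d < η x) (h₁ : -d ≤ y)
    (h₂ : y ≤ η x) : (x, y) ∈ closure {q : ℝ × ℝ | -d < q.2 ∧ q.2 < η q.1} := by
  have hy : y ∈ closure (Ioo (-d) (η x)) := by
    rw [closure_Ioo hηd.ne]
    exact ⟨h₁, h₂⟩
  exact map_mem_closure (f := fun y => (x, y)) (by fun_prop) hy fun _ h => h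

theorem deriv_nonpos_of_antitoneOn_Ioi {f : ℝ → ℝ} {a x : ℝ} (hf : AntitoneOn f (Ioi a))
    (hx : a < x) : deriv f x ≤ 0 := by
  rw [← derivWithin_of_isOpen isOpen_Ioi hx]
  exact hf.derivWithin_nonpos

/-- The vertical velocity is strictly positive in the right half
`Ω₊ = {(x,y) : x > 0, -d < y < η x}` of the fluid domain. -/
theorem vertical_velocity_positive
    (d g c P_atm : ℝ) (hd : 0 < d) (hg : 0 < g) (hc : Real.sqrt (g * d) < c)
    (η : ℝ → ℝ) (hη : ContDiff ℝ (⊤ : ℕ∞) η)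
    (hηd : ∀ x, -d < η x) (hηeven : ∀ x, η (-x) = η x)
    (hηdec : StrictAntiOn η (Set.Ioi 0))
    (hηlim : Filter.Tendsto η (Filter.cocompact ℝ) (nhds 0))
    (Ω : Set (ℝ × ℝ)) (hΩ : Ω = {q : ℝ × ℝ | -d < q.2 ∧ q.2 < η q.1})
    (u v : ℝ → ℝ → ℝ)
    (hu : ContDiff ℝ (⊤ : ℕ∞) (fun q : ℝ × ℝ => u q.1 q.2))
    (hv : ContDiff ℝ (⊤ : ℕ∞) (fun q : ℝ × ℝ => v q.1 q.2))
    (hinc : ∀ x y, (x, y) ∈ closure Ω → pdx u x y + pdy v x y = 0)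
    (hirr : ∀ x y, (x, y) ∈ closure Ω → pdy u x y - pdx v x y = 0)
    (hsurfv : ∀ x, v x (η x) = (u x (η x) - c) * deriv η x)
    (hbed : ∀ x, v x (-d) = 0)
    (hvsym : ∀ x y, v (-x) y = -v x y)
    (huc : ∀ x y, (x, y) ∈ closure Ω → u x y < c)
    (hvlim : ∀ ε > 0, ∃ R > 0, ∀ x y, (x, y) ∈ closure Ω → R < |x| → |v x y| < ε) :
    ∀ x y, 0 < x → -d < y → y < η x → 0 < v x y := by
  subst hΩ
  have hvzero (y : ℝ) : v 0 y = 0 := by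
    have := hvsym 0 y
    rw [neg_zero] at this
    linarith
  have hsurf (x : ℝ) (hx : 0 ≤ x) : 0 ≤ v x (η x) := by
    rcases hx.eq_or_lt with rfl | hx
    · exact (hvzero _).ge
    rw [hsurfv]
    exact mul_nonneg_of_nonpos_of_nonpos
      (sub_nonpos.2 (huc x _ (mem_closure_fluid (hηd x) (hηd x).le le_rfl)).le)
      (deriv_nonpos_of_antitoneOn_Ioi hηdec.antitoneOn hx)
  have hdiff (s : Set ℝ) : DifferentiableOn ℂ (expVelocity u v) (fluidOver d η s) := by
    intro z hz
    have hmem := mem_closure_fluid (hηd z.re) hz.2.1.le hz.2.2.le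
    exact (differentiableAt_expVelocity (hu.differentiable (by simp)).differentiableAt
      (hv.differentiable (by simp)).differentiableAt (hinc _ _ hmem)
      (hirr _ _ hmem)).differentiableWithinAt
  have hcont : Continuous (expVelocity u v) :=
    continuous_expVelocity hu.continuous hv.continuous
  have hnonneg (x y : ℝ) (hx : 0 < x) (hy₁ : -d < y) (hy₂ : y < η x) : 0 ≤ v x y := by
    refine le_of_forall_pos_le_add fun ε hε => ?_
    obtain ⟨R, hR, hvR⟩ := hvlim ε hε
    set b := max R x + 1
    have hRb : R < b := (le_max_left R x).trans_lt (lt_add_one _)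
    have hxb : x < b := (le_max_right R x).trans_lt (lt_add_one _)
    have hb : 0 < b := hR.trans hRb
    have hbound : ‖expVelocity u v ⟨x, y⟩‖ ≤ Real.exp ε := by
      refine Complex.norm_le_of_forall_mem_frontier_norm_le
        (isBounded_fluidOver hη.continuous (a := 0) (b := b))
        ⟨hdiff _, hcont.continuousOn⟩ (fun z hz => ?_)
        (subset_closure ⟨⟨hx, hxb⟩, hy₁, hy₂⟩)
      rw [norm_expVelocity, Real.exp_le_exp]
      obtain ⟨hzcl, hzn⟩ := hz
      rw [(isOpen_fluidOver hη.continuous isOpen_Ioo).interior_eq] at hzn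
      obtain ⟨hz, hz₁, hz₂⟩ := closure_fluidOver_subset hη.continuous hzcl
      rw [closure_Ioo hb.ne] at hz
      rcases hz.1.eq_or_lt with h | hl
      · rw [← h, hvzero]
        linarith
      rcases hz.2.eq_or_lt with h | hr
      · have := hvR z.re z.im (mem_closure_fluid (hηd _) hz₁ hz₂)
          (by rwa [h, abs_of_pos hb])
        linarith [(abs_lt.1 this).1]
      rcases hz₁.eq_or_lt with h | hbot
      · rw [← h, hbed]
        linarith
      rcases hz₂.eq_or_lt with h | htop
      · rw [h]
        linarith [hsurf z.re hl.le]
      · exact absurd ⟨⟨hl, hr⟩, hbot, htop⟩ hzn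
    rw [norm_expVelocity, Real.exp_le_exp] at hbound
    linarith
  intro x y hx hy₁ hy₂
  refine (hnonneg x y hx hy₁ hy₂).lt_of_ne fun hzero => ?_
  have hvanish : EqOn (norm ∘ expVelocity u v) (Function.const ℂ ‖expVelocity u v ⟨x, y⟩‖)
      (closure (fluidOver d η (Ioi 0))) := by
    refine Complex.norm_eqOn_closure_of_isPreconnected_of_isMaxOn
      (isPreconnected_fluidOver hη.continuous hηd isPreconnected_Ioi)
      (isOpen_fluidOver hη.continuous isOpen_Ioi) ⟨hdiff _, hcont.continuousOn⟩
      ⟨hx, hy₁, hy₂⟩ fun z hz => ?_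
    simpa [norm_expVelocity, ← hzero] using hnonneg _ _ hz.1 hz.2.1 hz.2.2
  have hflat (t : ℝ) (ht : t ∈ Ioi (0 : ℝ)) : deriv η t = 0 := by
    have hmem : (⟨t, η t⟩ : ℂ) ∈ closure (fluidOver d η (Ioi 0)) := by
      have ht' : η t ∈ closure (Ioo (-d) (η t)) := by
        rw [closure_Ioo (hηd t).ne]
        exact ⟨(hηd t).le, le_rfl⟩
      exact map_mem_closure (f := fun y : ℝ => (⟨t, y⟩ : ℂ))
        (Complex.equivRealProdCLM.symm.continuous.comp (by fun_prop : Continuous (Prod.mk t)))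
        ht' fun _ h => ⟨ht, h⟩
    have hv0 : v t (η t) = 0 := by
      simpa [norm_expVelocity, ← hzero] using hvanish hmem
    rw [hsurfv] at hv0
    exact (mul_eq_zero.1 hv0).resolve_left
      (sub_neg.2 (huc t _ (mem_closure_fluid (hηd t) (hηd t).le le_rfl))).ne
  have hconst : η 1 = η 2 :=
    isOpen_Ioi.is_const_of_deriv_eq_zero isPreconnected_Ioi
      (hη.differentiable (by simp)).differentiableOn hflat
      (by simp) (by simp)
  exact (hηdec (by simp) (by simp) one_lt_two).ne' hconst
end

section
/- On the vertical symmetry axis through the crest, the dynamic pressure satisfies p_y(0,y) = -(u(0,y) - c)·v_x(0,y) > 0 for every y with -d < y < η(0); consequently the map y ↦ p(0,y) is strictly increasing on [-d, η(0)], so p strictly decreases from the crest (0,η(0)) down to the point (0,-d) on the bed. -/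
open Real Filter Set

open Complex Metric

/-- The Cauchy–Riemann equations: if `a` and `b` satisfy them at `z`, then `a + i b` is complex
differentiable there, with derivative `a_x + i b_x`. -/
theorem hasDerivAt_of_cauchyRiemann {a b : ℝ → ℝ → ℝ} {z : ℂ}
    (ha : DifferentiableAt ℝ (fun q : ℝ × ℝ => a q.1 q.2) (z.re, z.im))
    (hb : DifferentiableAt ℝ (fun q : ℝ × ℝ => b q.1 q.2) (z.re, z.im))
    (h₁ : pdx a z.re z.im = pdy b z.re z.im) (h₂ : pdy a z.re z.im = -pdx b z.re z.im) :
    HasDerivAt (fun w : ℂ => (⟨a w.re w.im, b w.re w.im⟩ : ℂ))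
      ⟨pdx a z.re z.im, pdx b z.re z.im⟩ z := by
  have hpdx : ∀ {f : ℝ → ℝ → ℝ}, DifferentiableAt ℝ (fun q : ℝ × ℝ => f q.1 q.2) (z.re, z.im) →
      fderiv ℝ (fun q : ℝ × ℝ => f q.1 q.2) (z.re, z.im) (1, 0) = pdx f z.re z.im := by
    intro f hf
    exact (hf.hasFDerivAt.comp_hasDerivAt z.re
      ((hasDerivAt_id z.re).prodMk (hasDerivAt_const z.re z.im))).deriv.symm
  have hpdy : ∀ {f : ℝ → ℝ → ℝ}, DifferentiableAt ℝ (fun q : ℝ × ℝ => f q.1 q.2) (z.re, z.im) →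
      fderiv ℝ (fun q : ℝ × ℝ => f q.1 q.2) (z.re, z.im) (0, 1) = pdy f z.re z.im := by
    intro f hf
    exact (hf.hasFDerivAt.comp_hasDerivAt z.im
      ((hasDerivAt_const z.im z.re).prodMk (hasDerivAt_id z.im))).deriv.symm
  have hcoord : HasFDerivAt (fun w : ℂ => (w.re, w.im)) (reCLM.prod imCLM) z :=
    (reCLM.hasFDerivAt).prodMk imCLM.hasFDerivAt
  have hA := HasFDerivAt.comp z ha.hasFDerivAt hcoord
  have hB := HasFDerivAt.comp z hb.hasFDerivAt hcoord
  have hF := (equivRealProdCLM.symm : ℝ × ℝ →L[ℝ] ℂ).hasFDerivAt.comp z (hA.prodMk hB)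
  have hI : ∀ {f' : ℂ →L[ℝ] ℂ}, HasFDerivAt (fun w : ℂ => (⟨a w.re w.im, b w.re w.im⟩ : ℂ)) f' z →
      f' I = Complex.I • f' 1 →
      HasDerivAt (fun w : ℂ => (⟨a w.re w.im, b w.re w.im⟩ : ℂ)) (f' 1) z := by
    intro f' hf' hI
    have := (hf'.complexOfReal_hasFDerivAt hI).hasDerivAt
    simpa using this
  have key := hI hF (by
    apply Complex.ext <;>
      simp [hpdx ha, hpdy ha, hpdx hb, hpdy hb, h₁, h₂])
  convert key using 1
  apply Complex.ext <;> simp [hpdx ha, hpdx hb]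

theorem norm_exp_neg (w : ℂ) : ‖Complex.exp (-w)‖ = Real.exp (-w.re) := by
  simp [Complex.norm_exp]

/-- The minimum principle for the real part of a holomorphic function on a bounded set. -/
theorem le_re_of_forall_mem_frontier {F : ℂ → ℂ} {U : Set ℂ} {m : ℝ}
    (hU : Bornology.IsBounded U) (hF : DiffContOnCl ℂ F U)
    (hm : ∀ z ∈ frontier U, m ≤ (F z).re) {z : ℂ} (hz : z ∈ closure U) : m ≤ (F z).re := by
  have hexp : DiffContOnCl ℂ (fun w => Complex.exp (-F w)) U :=
    Complex.differentiable_exp.comp_diffContOnCl hF.neg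
  have := norm_le_of_forall_mem_frontier_norm_le hU hexp (C := Real.exp (-m))
    (fun w hw => by simpa [norm_exp_neg] using hm w hw) hz
  simpa [norm_exp_neg] using this

/-- Hopf's boundary-point lemma on a vertical axis of symmetry: if the real part of a holomorphic
function has the sign of `re (z - z₀)` near `z₀`, strictly so somewhere, then its horizontal
derivative at `z₀` is positive. -/
theorem re_deriv_pos_of_re_mul_re_nonneg {F : ℂ → ℂ} {z₀ z : ℂ} {R : ℝ}
    (hF : DifferentiableOn ℂ F (ball z₀ R)) (h₀ : (F z₀).re = 0)
    (hsign : ∀ w ∈ ball z₀ R, 0 ≤ (w - z₀).re * (F w).re) (hz : z ∈ ball z₀ R)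
    (hpos : 0 < (z - z₀).re * (F z).re) : 0 < (deriv F z₀).re := by
  set r := dist z z₀ with hr
  have hzne : z ≠ z₀ := by rintro rfl; simp at hpos
  have hr0 : 0 < r := dist_pos.2 hzne
  have hrR : r < R := hz
  have hsub : closedBall z₀ r ⊆ ball z₀ R := closedBall_subset_ball hrR
  set G : ℂ → ℂ := fun w => dslope F z₀ w * (1 + (w - z₀) ^ 2 / (r : ℂ) ^ 2) with hG
  have hGd : DifferentiableOn ℂ G (ball z₀ R) := by
    have := (differentiableOn_dslope (ball_mem_nhds z₀ (hr0.trans hrR))).2 hF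
    exact this.mul (by fun_prop)
  have hGcl : DiffContOnCl ℂ G (ball z₀ r) := (hGd.mono hsub).diffContOnCl_ball subset_rfl
  have hGsphere : ∀ w ∈ sphere z₀ r, (G w).re = 2 / r ^ 2 * ((w - z₀).re * (F w).re) := by
    intro w hw
    have hwne : w ≠ z₀ := by rintro rfl; simp at hw; exact hr0.ne hw
    have hnorm : normSq (w - z₀) = r ^ 2 := by
      rw [normSq_eq_norm_sq, ← dist_eq_norm, mem_sphere.1 hw]
    have hfac : (w - z₀)⁻¹ * (1 + (w - z₀) ^ 2 / (r : ℂ) ^ 2)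
        = ((2 / r ^ 2 * (w - z₀).re : ℝ) : ℂ) := by
      have hconj : (w - z₀)⁻¹ = starRingEnd ℂ (w - z₀) / (r : ℂ) ^ 2 := by
        rw [Complex.inv_def, hnorm]; push_cast; rw [div_eq_mul_inv]
      have hrc : (r : ℂ) ≠ 0 := by exact_mod_cast hr0.ne'
      calc (w - z₀)⁻¹ * (1 + (w - z₀) ^ 2 / (r : ℂ) ^ 2)
          = (w - z₀)⁻¹ + (w - z₀) / (r : ℂ) ^ 2 := by field_simp
        _ = (w - z₀ + starRingEnd ℂ (w - z₀)) / (r : ℂ) ^ 2 := by rw [hconj]; ring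
        _ = _ := by rw [add_conj]; push_cast; ring
    have : G w = ((2 / r ^ 2 * (w - z₀).re : ℝ) : ℂ) * (F w - F z₀) := by
      rw [← hfac, hG]
      simp only [dslope_of_ne _ hwne, slope, vsub_eq_sub, smul_eq_mul]
      ring
    rw [this, re_ofReal_mul, sub_re (F w), h₀]
    ring
  have hGnonneg : ∀ w ∈ ball z₀ r, 0 ≤ (G w).re := fun w hw =>
    le_re_of_forall_mem_frontier isBounded_ball hGcl (fun t ht => by
      rw [frontier_ball _ hr0.ne'] at ht
      rw [hGsphere t ht]
      exact mul_nonneg (by positivity) (hsign t (hsub (sphere_subset_closedBall ht))))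
      (subset_closure hw)
  have hG0 : G z₀ = deriv F z₀ := by simp [hG]
  by_contra hneg
  rw [not_lt, ← hG0] at hneg
  have hexp : DiffContOnCl ℂ (fun w => Complex.exp (-G w)) (ball z₀ r) :=
    Complex.differentiable_exp.comp_diffContOnCl hGcl.neg
  have hconst := norm_eqOn_closedBall_of_isMaxOn hexp (fun w hw => by
    simpa [norm_exp_neg] using hneg.trans (hGnonneg w hw)) (mem_closedBall.2 hr.ge)
  simp only [Function.comp_apply, norm_exp_neg, Function.const_apply, Real.exp_eq_exp,
    neg_inj] at hconst
  have hGz := hGsphere z hr.symm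
  have : 0 < (G z).re := by rw [hGz]; positivity
  linarith

/-- The region between a horizontal line and a continuous graph above it, over an interval, is
preconnected. -/
theorem isPreconnected_setOf_between {s : Set ℝ} (hs : IsPreconnected s) {η : ℝ → ℝ} {b : ℝ}
    (hη : Continuous η) (hb : ∀ x, b < η x) :
    IsPreconnected {z : ℂ | z.re ∈ s ∧ b < z.im ∧ z.im < η z.re} := by
  have himage : {z : ℂ | z.re ∈ s ∧ b < z.im ∧ z.im < η z.re} =
      (fun q : ℝ × ℝ => (q.1 : ℂ) + (b + q.2 * (η q.1 - b) : ℝ) * I) '' (s ×ˢ Ioo 0 1) := by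
    ext z
    constructor
    · rintro ⟨hzs, hzb, hzη⟩
      have hpos : 0 < η z.re - b := sub_pos.2 (hb _)
      refine ⟨(z.re, (z.im - b) / (η z.re - b)), ⟨hzs, div_pos (sub_pos.2 hzb) hpos,
        (div_lt_one hpos).2 (by linarith)⟩, ?_⟩
      apply Complex.ext <;> simp [div_mul_cancel₀ _ hpos.ne']
    · rintro ⟨⟨x, t⟩, ⟨hx, ht₀, ht₁⟩, rfl⟩
      have hpos : 0 < η x - b := sub_pos.2 (hb _)
      simp only [mem_ofPred_eq, add_re, ofReal_re, mul_re, ofReal_im, I_re, I_im, add_im, mul_im]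
      norm_num
      exact ⟨hx, mul_pos ht₀ hpos, by nlinarith⟩
  rw [himage]
  exact (hs.prod isPreconnected_Ioo).image _ (by fun_prop)

/-- A point between a line and a graph lies in the closure of the open region between them. -/
theorem mem_closure_between {η : ℝ → ℝ} {b x y : ℝ} (hb : b < η x) (hy : y ∈ Icc b (η x)) :
    (x, y) ∈ closure {q : ℝ × ℝ | b < q.2 ∧ q.2 < η q.1} := by
  rw [← closure_Ioo hb.ne] at hy
  exact closure_mono (by rintro _ ⟨t, ht, rfl⟩; exact ht)
    (image_closure_subset_closure_image (f := fun t : ℝ => (x, t)) (by fun_prop) ⟨y, hy, rfl⟩)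

/-- Phragmén–Lindelöf type minimum principle in the right half of a strip under a graph: a
real part which is nonnegative on the boundary and small at infinity is nonnegative. -/
theorem re_nonneg_of_right_half_strip {F : ℂ → ℂ} {η : ℝ → ℝ} {b : ℝ} (hη : Continuous η)
    (hF : Continuous F) (hFd : ∀ z : ℂ, b < z.im → z.im < η z.re → DifferentiableAt ℂ F z)
    (haxis : ∀ z : ℂ, z.re = 0 → 0 ≤ (F z).re) (hbed : ∀ z : ℂ, z.im = b → 0 ≤ (F z).re)
    (hsurf : ∀ z : ℂ, 0 < z.re → z.im = η z.re → 0 ≤ (F z).re)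
    (hlim : ∀ ε > 0, ∃ R > 0, ∀ z : ℂ, z.im ∈ Icc b (η z.re) → R < z.re → -ε ≤ (F z).re)
    {z : ℂ} (hz₀ : 0 < z.re) (hzb : b < z.im) (hzη : z.im < η z.re) : 0 ≤ (F z).re := by
  refine le_of_forall_pos_le_add fun ε hε => ?_
  obtain ⟨R, hR, hRF⟩ := hlim ε hε
  set T := max (R + 1) (z.re + 1)
  have hTR : R < T := (lt_add_one R).trans_le (le_max_left _ _)
  have hTz : z.re < T := (lt_add_one _).trans_le (le_max_right _ _)
  let U : Set ℂ := {w | 0 < w.re ∧ w.re < T ∧ b < w.im ∧ w.im < η w.re}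
  have hηre : Continuous fun w : ℂ => η w.re := hη.comp continuous_re
  have hUo : IsOpen U :=
    (isOpen_lt continuous_const continuous_re).inter
      ((isOpen_lt continuous_re continuous_const).inter
        ((isOpen_lt continuous_const continuous_im).inter (isOpen_lt continuous_im hηre)))
  have hUcl : closure U ⊆ {w | 0 ≤ w.re ∧ w.re ≤ T ∧ b ≤ w.im ∧ w.im ≤ η w.re} := by
    refine closure_minimal (fun w hw => ⟨hw.1.le, hw.2.1.le, hw.2.2.1.le, hw.2.2.2.le⟩) ?_
    exact (isClosed_le continuous_const continuous_re).inter
      ((isClosed_le continuous_re continuous_const).inter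
        ((isClosed_le continuous_const continuous_im).inter (isClosed_le continuous_im hηre)))
  have hUb : Bornology.IsBounded U := by
    obtain ⟨M, hM⟩ := (isCompact_Icc (a := (0 : ℝ)) (b := T)).bddAbove_image hη.continuousOn
    refine ((isBounded_Icc 0 T).reProdIm (isBounded_Icc b M)).subset fun w hw => ?_
    have hwT : w.re ∈ Icc 0 T := ⟨hw.1.le, hw.2.1.le⟩
    exact ⟨hwT, hw.2.2.1.le, hw.2.2.2.le.trans (hM ⟨w.re, hwT, rfl⟩)⟩
  have hFU : DiffContOnCl ℂ F U :=
    ⟨fun w hw => (hFd w hw.2.2.1 hw.2.2.2).differentiableWithinAt, hF.continuousOn⟩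
  have := le_re_of_forall_mem_frontier hUb hFU (m := -ε) (fun w hw => by
    rw [hUo.frontier_eq] at hw
    obtain ⟨h₁, h₂, h₃, h₄⟩ := hUcl hw.1
    rcases h₁.eq_or_lt with h₁ | h₁'
    · linarith [haxis w h₁.symm]
    rcases h₂.eq_or_lt with h₂ | h₂'
    · exact hRF w ⟨h₃, h₄⟩ (h₂ ▸ hTR)
    rcases h₃.eq_or_lt with h₃ | h₃'
    · linarith [hbed w h₃.symm]
    rcases h₄.eq_or_lt with h₄ | h₄'
    · linarith [hsurf w h₁' h₄]
    exact absurd ⟨h₁', h₂', h₃', h₄'⟩ hw.2) (subset_closure ⟨hz₀, hTz, hzb, hzη⟩)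
  linarith

/-- The strong minimum principle for the real part of a holomorphic function. -/
theorem re_eq_zero_of_isPreconnected {F : ℂ → ℂ} {U : Set ℂ} (hU : IsPreconnected U)
    (hUo : IsOpen U) (hF : DifferentiableOn ℂ F U) (hnonneg : ∀ z ∈ U, 0 ≤ (F z).re) {z w : ℂ}
    (hz : z ∈ U) (hz₀ : (F z).re = 0) (hw : w ∈ U) : (F w).re = 0 := by
  have := norm_eqOn_of_isPreconnected_of_isMaxOn hU hUo
    (Complex.differentiable_exp.comp_differentiableOn hF.neg) hz (fun t ht => by
      simpa [norm_exp_neg, hz₀] using hnonneg t ht) hw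
  simpa [norm_exp_neg, hz₀] using this

/-- On the vertical symmetry axis through the crest, the dynamic pressure satisfies
`p_y(0,y) = -(u(0,y) - c)·v_x(0,y) > 0` for `-d < y < η 0`; consequently `y ↦ p(0,y)`
is strictly increasing on `[-d, η 0]`, so `p` strictly decreases from the crest
down to the point `(0,-d)` on the bed. -/
theorem dynamic_pressure_increasing_on_axis
    (d g c P_atm : ℝ) (hd : 0 < d) (hg : 0 < g) (hc : Real.sqrt (g * d) < c)
    (η : ℝ → ℝ) (hη : ContDiff ℝ (⊤ : ℕ∞) η)
    (hηd : ∀ x, -d < η x) (hηeven : ∀ x, η (-x) = η x)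
    (hηdec : StrictAntiOn η (Set.Ioi 0))
    (hηlim : Filter.Tendsto η (Filter.cocompact ℝ) (nhds 0))
    (Ω : Set (ℝ × ℝ)) (hΩ : Ω = {q : ℝ × ℝ | -d < q.2 ∧ q.2 < η q.1})
    (u v : ℝ → ℝ → ℝ)
    (hu : ContDiff ℝ (⊤ : ℕ∞) (fun q : ℝ × ℝ => u q.1 q.2))
    (hv : ContDiff ℝ (⊤ : ℕ∞) (fun q : ℝ × ℝ => v q.1 q.2))
    (hinc : ∀ x y, (x, y) ∈ closure Ω → pdx u x y + pdy v x y = 0)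
    (hirr : ∀ x y, (x, y) ∈ closure Ω → pdy u x y - pdx v x y = 0)
    (hsurfv : ∀ x, v x (η x) = (u x (η x) - c) * deriv η x)
    (hbed : ∀ x, v x (-d) = 0)
    (hvsym : ∀ x y, v (-x) y = -v x y)
    (huc : ∀ x y, (x, y) ∈ closure Ω → u x y < c)
    (hvlim : ∀ ε > 0, ∃ R > 0, ∀ x y, (x, y) ∈ closure Ω → R < |x| → |v x y| < ε)
    (p : ℝ → ℝ → ℝ)
    (hp : ∀ x y, p x y = c ^ 2 / 2 - (1 / 2) * ((v x y) ^ 2 + (u x y - c) ^ 2)) :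
    (∀ y : ℝ, -d < y → y < η 0 →
      pdy p 0 y = -(u 0 y - c) * pdx v 0 y ∧ 0 < pdy p 0 y) ∧
    StrictMonoOn (fun y => p 0 y) (Set.Icc (-d) (η 0)) := by
  have hud : Differentiable ℝ (fun q : ℝ × ℝ => u q.1 q.2) := hu.differentiable (by simp)
  have hvd : Differentiable ℝ (fun q : ℝ × ℝ => v q.1 q.2) := hv.differentiable (by simp)
  have hηd' : Differentiable ℝ η := hη.differentiable (by simp)
  have hcl : ∀ x, ∀ y ∈ Icc (-d) (η x), (x, y) ∈ closure Ω := fun x y hy =>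
    hΩ ▸ mem_closure_between (hηd x) hy
  have hv0 : ∀ y, v 0 y = 0 := fun y => by
    have := hvsym 0 y
    rw [neg_zero] at this
    linarith
  set F : ℂ → ℂ := fun w => ⟨v w.re w.im, u w.re w.im⟩ with hF
  have hFderiv : ∀ z : ℂ, z.im ∈ Icc (-d) (η z.re) →
      HasDerivAt F ⟨pdx v z.re z.im, pdx u z.re z.im⟩ z := fun z hz =>
    hasDerivAt_of_cauchyRiemann (hvd _) (hud _)
      (by linarith [hirr _ _ (hcl _ _ hz)]) (by linarith [hinc _ _ (hcl _ _ hz)])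
  have hFc : Continuous F := by
    have hcoord : Continuous fun w : ℂ => (w.re, w.im) := by fun_prop
    exact equivRealProdCLM.symm.continuous.comp
      ((hvd.continuous.comp hcoord).prodMk (hud.continuous.comp hcoord))
  have hηneg : ∀ x, 0 < x → deriv η x ≤ 0 := fun x hx => by
    rw [← derivWithin_of_isOpen isOpen_Ioi hx]
    exact hηdec.antitoneOn.derivWithin_nonpos
  have husurf : ∀ x, u x (η x) - c < 0 := fun x =>
    sub_neg.2 (huc _ _ (hcl x _ ⟨(hηd x).le, le_rfl⟩))
  have hvnonneg : ∀ z : ℂ, 0 < z.re → -d < z.im → z.im < η z.re → 0 ≤ (F z).re := by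
    intro z
    refine re_nonneg_of_right_half_strip hη.continuous hFc
      (fun w h₁ h₂ => (hFderiv w ⟨h₁.le, h₂.le⟩).differentiableAt)
      (fun w hw => ?_) (fun w hw => ?_) (fun w hw hwη => ?_) (fun ε hε => ?_)
    · simp [hF, hw, hv0]
    · simp [hF, hw, hbed]
    · simp only [hF, hwη, hsurfv]
      exact mul_nonneg_of_nonpos_of_nonpos (husurf _).le (hηneg _ hw)
    · obtain ⟨R, hR, h⟩ := hvlim ε hε
      refine ⟨R, hR, fun w hw hwR => ?_⟩
      exact (abs_lt.1 (h _ _ (hcl _ _ hw) (hwR.trans_le (le_abs_self _)))).1.le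
  let U : Set ℂ := {z | z.re ∈ Ioi (0 : ℝ) ∧ -d < z.im ∧ z.im < η z.re}
  have hηre : Continuous fun w : ℂ => η w.re := hη.continuous.comp continuous_re
  have hUo : IsOpen U :=
    (isOpen_lt continuous_const continuous_re).inter
      ((isOpen_lt continuous_const continuous_im).inter (isOpen_lt continuous_im hηre))
  have hvpos : ∀ z ∈ U, 0 < (F z).re := by
    intro z hz
    refine (hvnonneg z hz.1 hz.2.1 hz.2.2).lt_of_ne' fun hz₀ => ?_
    have hzero : ∀ w ∈ U, (F w).re = 0 := fun w hw =>
      re_eq_zero_of_isPreconnected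
        (isPreconnected_setOf_between isPreconnected_Ioi hη.continuous hηd) hUo
        (fun t ht => (hFderiv t ⟨ht.2.1.le, ht.2.2.le⟩).differentiableAt.differentiableWithinAt)
        (fun t ht => hvnonneg t ht.1 ht.2.1 ht.2.2) hz hz₀ hw
    have hsurf : ∀ x, 0 < x → v x (η x) = 0 := by
      intro x hx
      have hvx : Continuous (v x) := hvd.continuous.comp (by fun_prop : Continuous fun t => (x, t))
      have hclosed : closure (Ioo (-d) (η x)) ⊆ {t | v x t = 0} :=
        closure_minimal (fun t ht => hzero ⟨x, t⟩ ⟨hx, ht⟩) (isClosed_eq hvx continuous_const)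
      rw [closure_Ioo (hηd x).ne] at hclosed
      exact hclosed ⟨(hηd x).le, le_rfl⟩
    have hηmono : MonotoneOn η (Ioi 0) := by
      refine monotoneOn_of_deriv_nonneg (convex_Ioi 0) hη.continuous.continuousOn
        hηd'.differentiableOn fun x hx => ?_
      rw [interior_Ioi] at hx
      have := hsurf x hx
      rw [hsurfv] at this
      exact ((mul_eq_zero.1 this).resolve_left (husurf x).ne).ge
    have h₁₂ : (1 : ℝ) < 2 := one_lt_two
    exact absurd (hηdec (mem_Ioi.2 one_pos) (mem_Ioi.2 two_pos) h₁₂)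
      (hηmono (mem_Ioi.2 one_pos) (mem_Ioi.2 two_pos) h₁₂.le).not_gt
  have hpd : ∀ y, HasDerivAt (fun t => p 0 t) (-(u 0 y - c) * pdy u 0 y) y := by
    intro y
    have huy : HasDerivAt (u 0) (pdy u 0 y) y := by
      have : DifferentiableAt ℝ (u 0) y :=
        (hud (0, y)).comp y (by fun_prop : DifferentiableAt ℝ (fun t : ℝ => ((0 : ℝ), t)) y)
      exact this.hasDerivAt
    have hpu : (fun t => p 0 t) = fun t => c ^ 2 / 2 - (1 / 2) * (u 0 t - c) ^ 2 := by
      ext t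
      simp [hp, hv0]
    rw [hpu]
    refine ((((huy.sub_const c).pow 2).const_mul (1 / 2)).const_sub (c ^ 2 / 2)).congr_deriv ?_
    ring
  have hpdy : ∀ y : ℝ, -d < y → y < η 0 →
      pdy p 0 y = -(u 0 y - c) * pdx v 0 y ∧ 0 < pdy p 0 y := by
    intro y hy₁ hy₂
    have hmem := hcl 0 y ⟨hy₁.le, hy₂.le⟩
    have heq : pdy p 0 y = -(u 0 y - c) * pdx v 0 y := by
      rw [pdy, (hpd y).deriv, sub_eq_zero.1 (hirr _ _ hmem)]
    refine ⟨heq, heq ▸ mul_pos (by linarith [huc _ _ hmem]) ?_⟩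
    have hopen : IsOpen {z : ℂ | -d < z.im ∧ z.im < η z.re} :=
      (isOpen_lt continuous_const continuous_im).inter (isOpen_lt continuous_im hηre)
    obtain ⟨R, hR, hball⟩ := Metric.isOpen_iff.1 hopen ⟨0, y⟩ ⟨hy₁, hy₂⟩
    have hz : (⟨R / 2, y⟩ : ℂ) ∈ ball (⟨0, y⟩ : ℂ) R := by
      rw [mem_ball, Complex.dist_of_im_eq (by rfl), Real.dist_eq]
      simp only [sub_zero]
      rw [abs_of_pos (half_pos hR)]
      exact half_lt_self hR
    have hderiv : deriv F ⟨0, y⟩ = ⟨pdx v 0 y, pdx u 0 y⟩ :=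
      (hFderiv ⟨0, y⟩ ⟨hy₁.le, hy₂.le⟩).deriv
    have := re_deriv_pos_of_re_mul_re_nonneg (F := F) (z₀ := ⟨0, y⟩) (z := ⟨R / 2, y⟩) (R := R)
      (fun w hw => (hFderiv w ⟨(hball hw).1.le, (hball hw).2.le⟩).differentiableAt
        |>.differentiableWithinAt)
      (hv0 y) (fun w hw => ?_) hz ?_
    · rwa [hderiv] at this
    · obtain ⟨h₁, h₂⟩ := hball hw
      simp only [sub_re, sub_zero]
      rcases lt_trichotomy w.re 0 with h | h | h
      · have := hvpos ⟨-w.re, w.im⟩ ⟨neg_pos.2 h, h₁, by rw [hηeven]; exact h₂⟩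
        simp only [hF, hvsym] at this ⊢
        exact mul_nonneg_of_nonpos_of_nonpos h.le (by linarith)
      · simp [h]
      · exact mul_nonneg h.le (hvpos w ⟨h, h₁, h₂⟩).le
    · simp only [sub_re, sub_zero]
      exact mul_pos (half_pos hR) (hvpos _ ⟨half_pos hR, hball hz⟩)
  refine ⟨hpdy, strictMonoOn_of_deriv_pos (convex_Icc _ _)
    (fun y _ => (hpd y).continuousAt.continuousWithinAt) fun y hy => ?_⟩
  rw [interior_Icc] at hy
  exact (hpdy y hy.1 hy.2).2
end
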